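/- arXiv:2603.24519 — 2 statements merged into one kernel-verified Lean document; each statement's English description precedes it below -/
import Mathlib

section
/- Let U ⊆ ℂⁿ be an open set such that the slice U_w is nonempty and connected for every w ∈ ℂ^{n−1}, and let h : U → ℂ be holomorphic and nowhere vanishing. Let Z ⊆ ℂⁿ be a closed set with Z ∩ U = ∅ such that the slice Z_w is discrete in ℂ for every w ∈ ℂ^{n−1}, and let f : ℂⁿ ∖ Z → ℂ be holomorphic with f(z, w) = (∂_z h(z, w)) / h(z, w) for all (z, w) ∈ U, where ∂_z denotes the complex derivative in the first variable. Assume: (a) every point p ∈ ℂⁿ has an open neighborhood V carrying holomorphic functions g, q : V → ℂ such that q does not vanish identically on any nonempty open subset of V, Z ∩ V ⊆ q⁻¹(0), and q·f = g on V ∖ Z (f is meromorphic on ℂⁿ); (b) for every (z, w) ∈ Z there is a nonnegative integer m such that (z′ − z)·f(z′, w) → m as z′ → z with z′ ∉ Z_w (each slice singularity of f is removable or a simple pole with positive integer residue). Then there exists an entire function h̃ : ℂⁿ → ℂ with h̃ = h on U. -/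
section

open Set Filter Topology Metric
open scoped BoundedContinuousFunction

/-- The multilinear map on bounded continuous functions acting pointwise as `f`. -/
noncomputable def ContinuousMultilinearMap.pointwise {α : Type*} [TopologicalSpace α]
    {E F : Type*} [NormedAddCommGroup E] [NormedSpace ℂ E] [NormedAddCommGroup F]
    [NormedSpace ℂ F] {n : ℕ} (f : ContinuousMultilinearMap ℂ (fun _ : Fin n => E) F) :
    ContinuousMultilinearMap ℂ (fun _ : Fin n => α →ᵇ E) (α →ᵇ F) :=
  MultilinearMap.mkContinuous
    { toFun := fun v => BoundedContinuousFunction.ofNormedAddCommGroup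
        (fun a => f fun i => v i a) (by fun_prop) (‖f‖ * ∏ i, ‖v i‖)
        (fun a => f.le_opNorm_mul_prod_of_le fun i => (v i).norm_coe_le_norm a)
      map_update_add' := by
        intro _ v i x y
        ext a
        have key : ∀ z : α →ᵇ E, (fun j => Function.update v i z j a) =
            Function.update (fun j => v j a) i (z a) := by
          intro z; ext j
          by_cases hj : j = i
          · subst hj; simp
          · simp [hj]
        simp [key]
      map_update_smul' := by
        intro _ v i c x
        ext a
        have key : ∀ z : α →ᵇ E, (fun j => Function.update v i z j a) =
            Function.update (fun j => v j a) i (z a) := by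
          intro z; ext j
          by_cases hj : j = i
          · subst hj; simp
          · simp [hj]
        simp [key] }
    ‖f‖ fun v => by
      refine (BoundedContinuousFunction.norm_le (by positivity)).2 fun a => ?_
      exact f.le_opNorm_mul_prod_of_le fun i => (v i).norm_coe_le_norm a

section

variable {α : Type*} [TopologicalSpace α] {E F : Type*} [NormedAddCommGroup E] [NormedSpace ℂ E]
  [NormedAddCommGroup F] [NormedSpace ℂ F]

theorem ContinuousMultilinearMap.pointwise_apply {n : ℕ}
    (f : ContinuousMultilinearMap ℂ (fun _ : Fin n => E) F) (v : Fin n → α →ᵇ E) (a : α) :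
    f.pointwise v a = f fun i => v i a := rfl

theorem ContinuousMultilinearMap.norm_pointwise_le {n : ℕ}
    (f : ContinuousMultilinearMap ℂ (fun _ : Fin n => E) F) :
    ‖(f.pointwise : ContinuousMultilinearMap ℂ (fun _ : Fin n => α →ᵇ E) (α →ᵇ F))‖ ≤ ‖f‖ :=
  MultilinearMap.mkContinuous_norm_le _ (norm_nonneg _) _

/-- Superposition with an analytic function is analytic on bounded continuous functions of
small norm. -/
theorem exists_analyticAt_superposition [CompleteSpace F] {G : E → F} {c : E}
    (hG : AnalyticAt ℂ G c) :
    ∃ r > 0, ∃ Φ : (α →ᵇ E) → (α →ᵇ F),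
      ∀ v : α →ᵇ E, ‖v‖ < r → AnalyticAt ℂ Φ v ∧ ∀ a, Φ v a = G (c + v a) := by
  obtain ⟨p, R, hp⟩ := hG
  let q : FormalMultilinearSeries ℂ (α →ᵇ E) (α →ᵇ F) := fun n => (p n).pointwise
  have hpq : p.radius ≤ q.radius :=
    FormalMultilinearSeries.radius_le_of_le fun n => (p n).norm_pointwise_le
  have hq0 : 0 < q.radius := hp.r_pos.trans_le (hp.r_le.trans hpq)
  have hq := q.hasFPowerSeriesOnBall hq0
  obtain ⟨r, hr0, hrR⟩ := ENNReal.lt_iff_exists_nnreal_btwn.1 hp.r_pos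
  have hr0' : 0 < r := by exact_mod_cast hr0
  refine ⟨r, by exact_mod_cast hr0', q.sum, fun v hv => ?_⟩
  have hvR : ‖v‖ₑ < R := lt_trans (by
    rw [enorm_eq_nnnorm]; exact_mod_cast hv) hrR
  have hvq : v ∈ Metric.eball 0 q.radius := by
    rw [Metric.mem_eball, edist_zero_right]
    exact hvR.trans_le (hp.r_le.trans hpq)
  refine ⟨hq.analyticAt_of_mem hvq, fun a => ?_⟩
  have h1 := (hq.hasSum hvq).mapL (BoundedContinuousFunction.evalCLM ℂ a)
  have hva : v a ∈ Metric.eball (0 : E) R := by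
    rw [Metric.mem_eball, edist_zero_right]
    refine lt_of_le_of_lt ?_ hvR
    rw [enorm_eq_nnnorm, enorm_eq_nnnorm]
    exact_mod_cast v.norm_coe_le_norm a
  have h2 := hp.hasSum hva
  rw [zero_add] at h1
  exact h1.unique h2

/-- Integration over a compact interval, as a continuous linear map. -/
theorem exists_clm_intervalIntegral (s t : ℝ) :
    ∃ L : (ℝ →ᵇ ℂ) →L[ℂ] ℂ, ∀ v : ℝ →ᵇ ℂ, L v = ∫ x in s..t, v x := by
  refine ⟨LinearMap.mkContinuous
    { toFun := fun v => ∫ x in s..t, v x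
      map_add' := fun v w => intervalIntegral.integral_add
        (v.continuous.intervalIntegrable _ _) (w.continuous.intervalIntegrable _ _)
      map_smul' := fun c v => intervalIntegral.integral_smul c _ } |t - s| fun v => ?_,
    fun v => rfl⟩
  rw [mul_comm]
  exact intervalIntegral.norm_integral_le_of_norm_le_const fun x _ => v.norm_coe_le_norm x

theorem exists_nhds_analyticAt_intervalIntegral {G : E × ℂ → ℂ} {γ : ℝ → ℂ}
    (hγ : Continuous γ) {x₀ : E} {t₀ : ℝ} (hG : AnalyticAt ℂ G (x₀, γ t₀)) :
    ∃ ε > 0, ∀ s t : ℝ, s ≤ t → Icc s t ⊆ ball t₀ ε →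
      AnalyticAt ℂ (fun x => ∫ θ in s..t, G (x, γ θ)) x₀ := by
  obtain ⟨r, hr, Φ, hΦ⟩ := exists_analyticAt_superposition (α := ℝ) hG
  obtain ⟨ε, hε, hεr⟩ := Metric.continuousAt_iff.1 hγ.continuousAt (r / 2) (half_pos hr)
  refine ⟨ε, hε, fun s t hst hsub => ?_⟩
  let p : ℝ → ℂ := fun θ => γ (projIcc s t hst θ) - γ t₀
  have hp : ∀ θ, ‖p θ‖ ≤ r / 2 := fun θ => by
    have := hεr (hsub (projIcc s t hst θ).2)
    rw [dist_eq_norm] at this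
    exact this.le
  have hpc : Continuous p :=
    (hγ.comp (continuous_subtype_val.comp continuous_projIcc)).sub continuous_const
  let P : ℝ →ᵇ ℂ := BoundedContinuousFunction.ofNormedAddCommGroup p hpc (r / 2) hp
  let A : E →L[ℂ] (ℝ →ᵇ (E × ℂ)) :=
    (ContinuousLinearMap.compLeftContinuousBounded ℝ (ContinuousLinearMap.inl ℂ E ℂ)).comp
      (LinearMap.mkContinuous (𝕜 := ℂ) (σ := RingHom.id ℂ)
        { toFun := fun x => BoundedContinuousFunction.const ℝ x
          map_add' := fun x y => rfl
          map_smul' := fun c x => rfl } 1 fun x => by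
          rw [one_mul]
          exact BoundedContinuousFunction.norm_const_le x)
  let Q : ℝ →ᵇ (E × ℂ) :=
    ContinuousLinearMap.compLeftContinuousBounded ℝ (ContinuousLinearMap.inr ℂ E ℂ) P
  let u : E → (ℝ →ᵇ (E × ℂ)) := fun x => A (x - x₀) + Q
  have hu : ∀ x θ, u x θ = (x - x₀, p θ) := by
    intro x θ
    change ((x - x₀, (0 : ℂ)) : E × ℂ) + ((0 : E), p θ) = _
    simp
  have hun : ‖u x₀‖ < r := by
    refine lt_of_le_of_lt ((BoundedContinuousFunction.norm_le (half_pos hr).le).2 fun θ => ?_)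
      (half_lt_self hr)
    rw [hu]
    simpa using hp θ
  have hua : AnalyticAt ℂ u x₀ :=
    ((A.analyticAt _).comp (analyticAt_id.sub analyticAt_const)).add analyticAt_const
  obtain ⟨L, hL⟩ := exists_clm_intervalIntegral s t
  have hmain : AnalyticAt ℂ (fun x => L (Φ (u x))) x₀ :=
    (L.analyticAt _).comp ((hΦ _ hun).1.comp hua)
  refine hmain.congr ?_
  filter_upwards [hua.continuousAt.norm.eventually_lt continuousAt_const hun] with x hx
  rw [hL]
  refine intervalIntegral.integral_congr fun θ hθ => ?_
  rw [uIcc_of_le hst] at hθ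
  simp only [(hΦ _ hx).2, hu, p, projIcc_of_mem hst hθ]
  simp

/-- A parametric integral over a compact interval of an analytic function is analytic in the
parameter. -/
theorem AnalyticAt.intervalIntegral {G : E × ℂ → ℂ} {γ : ℝ → ℂ} (hγ : Continuous γ) {x₀ : E}
    {a b : ℝ} (hab : a ≤ b) (hG : ∀ t ∈ Icc a b, AnalyticAt ℂ G (x₀, γ t)) :
    AnalyticAt ℂ (fun x => ∫ θ in a..b, G (x, γ θ)) x₀ := by
  choose! ε hε hloc using fun t ht => exists_nhds_analyticAt_intervalIntegral hγ (hG t ht)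
  obtain ⟨t, ht0, htm, ⟨m, hm⟩, hc⟩ := exists_monotone_Icc_subset_open_cover_Icc hab
    (c := fun i : Icc a b => (Subtype.val ⁻¹' ball (i : ℝ) (ε i)))
    (fun i => isOpen_ball.preimage continuous_subtype_val)
    (fun i _ => mem_iUnion.2 ⟨i, mem_ball_self (hε _ i.2)⟩)
  have hsum : AnalyticAt ℂ (fun x => ∑ k ∈ Finset.range m,
      ∫ θ in (t k : ℝ)..(t (k + 1) : ℝ), G (x, γ θ)) x₀ := by
    refine Finset.analyticAt_fun_sum _ fun k _ => ?_
    obtain ⟨i, hi⟩ := hc k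
    refine hloc i i.2 _ _ (htm k.le_succ) fun θ hθ => ?_
    exact hi (a := ⟨θ, (t k).2.1.trans hθ.1, hθ.2.trans (t (k + 1)).2.2⟩) hθ
  refine hsum.congr ?_
  have hev : ∀ᶠ x in 𝓝 x₀, ∀ θ ∈ Icc a b, AnalyticAt ℂ G (x, γ θ) := by
    refine isCompact_Icc.eventually_forall_of_forall_eventually fun θ hθ => ?_
    have hc : ContinuousAt (fun z : E × ℝ => (z.1, γ z.2)) (x₀, θ) := by fun_prop
    exact hc.eventually (hG θ hθ).eventually_analyticAt
  filter_upwards [hev] with x hx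
  rw [intervalIntegral.sum_integral_adjacent_intervals, ht0, hm m le_rfl]
  intro k _
  have hk : (t k : ℝ) ≤ t (k + 1) := htm k.le_succ
  refine ContinuousOn.intervalIntegrable ?_
  rw [uIcc_of_le hk]
  intro θ hθ
  have := (hx θ ⟨(t k).2.1.trans hθ.1, hθ.2.trans (t (k + 1)).2.2⟩).continuousAt
  exact (ContinuousAt.comp (f := fun θ : ℝ => (x, γ θ)) this (by fun_prop)).continuousWithinAt

end

/-- Two solutions of `H' = φ H` off a closed set agreeing at a regular point coincide. -/
theorem eqOn_of_deriv_eq_mul {S V : Set ℂ} (hS : IsClosed S) (hV : IsOpen V)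
    (hVc : IsPreconnected V) {φ H₁ H₂ : ℂ → ℂ} (h₁ : DifferentiableOn ℂ H₁ V)
    (h₂ : DifferentiableOn ℂ H₂ V) (hd₁ : ∀ z ∈ V \ S, deriv H₁ z = φ z * H₁ z)
    (hd₂ : ∀ z ∈ V \ S, deriv H₂ z = φ z * H₂ z) {a : ℂ} (ha : a ∈ V \ S)
    (heq : H₁ a = H₂ a) (hne : H₂ a ≠ 0) : EqOn H₁ H₂ V := by
  have hVS : IsOpen (V \ S) := hV.sdiff hS
  have hev : ∀ᶠ z in 𝓝 a, z ∈ V \ S ∧ H₂ z ≠ 0 :=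
    (show ∀ᶠ z in 𝓝 a, z ∈ V \ S from hVS.mem_nhds ha).and
      (((h₂.differentiableAt (hV.mem_nhds ha.1)).continuousAt).eventually_ne hne)
  obtain ⟨r, hr, hball⟩ := Metric.eventually_nhds_iff_ball.1 hev
  have hdiff : ∀ z ∈ ball a r, HasDerivAt (fun z => H₁ z / H₂ z) 0 z := by
    intro z hz
    obtain ⟨hzV, hz2⟩ := hball z hz
    have e1 := (h₁.differentiableAt (hV.mem_nhds hzV.1)).hasDerivAt
    have e2 := (h₂.differentiableAt (hV.mem_nhds hzV.1)).hasDerivAt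
    have e := e1.fun_div e2 hz2
    rw [hd₁ z hzV, hd₂ z hzV] at e
    have h0 : (φ z * H₁ z * H₂ z - H₁ z * (φ z * H₂ z)) / H₂ z ^ 2 = 0 := by
      rw [div_eq_zero_iff]; left; ring
    rwa [h0] at e
  refine (h₁.analyticOnNhd hV).eqOn_of_preconnected_of_eventuallyEq (h₂.analyticOnNhd hV) hVc
    ha.1 ?_
  filter_upwards [ball_mem_nhds a hr] with z hz
  have hconst := isOpen_ball.is_const_of_deriv_eq_zero (convex_ball a r).isPreconnected
    (fun w hw => (hdiff w hw).differentiableAt.differentiableWithinAt)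
    (fun w hw => (hdiff w hw).deriv) hz (mem_ball_self hr)
  simp only [heq, div_self hne] at hconst
  exact (div_eq_one_iff_eq (hball z hz).2).1 hconst

/-- On a disc, a function with finitely many simple poles with natural residues is a
logarithmic derivative. -/
theorem exists_deriv_eq_mul_ball_finset (c : ℂ) (R : ℝ) (F : Finset ℂ) :
    ∀ φ : ℂ → ℂ, DifferentiableOn ℂ φ (ball c R \ F) →
      (∀ p ∈ F, ∃ m : ℕ, Tendsto (fun z => (z - p) * φ z) (𝓝[≠] p) (𝓝 (m : ℂ))) →
      ∃ H : ℂ → ℂ, DifferentiableOn ℂ H (ball c R) ∧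
        ∀ z ∈ ball c R \ F, H z ≠ 0 ∧ deriv H z = φ z * H z := by
  induction F using Finset.induction_on with
  | empty =>
    intro φ hφ _
    obtain ⟨g, hg⟩ := DifferentiableOn.isExactOn_ball (by simpa using hφ)
    have hH : ∀ z ∈ ball c R, HasDerivAt (fun z => Complex.exp (g z)) (φ z * Complex.exp (g z)) z :=
      fun z hz => by simpa [mul_comm] using (hg z hz).cexp
    exact ⟨_, fun z hz => (hH z hz).differentiableAt.differentiableWithinAt,
      fun z hz => ⟨Complex.exp_ne_zero _, (hH z hz.1).deriv⟩⟩
  | insert p F hpF ih =>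
    intro φ hφ hres
    obtain ⟨m, hm⟩ := hres p (Finset.mem_insert_self p F)
    let ψ₀ : ℂ → ℂ := fun z => φ z - m / (z - p)
    let ψ : ℂ → ℂ := Function.update ψ₀ p (limUnder (𝓝[≠] p) ψ₀)
    have hψ₀ : DifferentiableOn ℂ ψ₀ (ball c R \ (insert p F : Finset ℂ)) := by
      refine hφ.sub ((differentiableOn_const _).div (by fun_prop) fun z hz => ?_)
      rw [sub_ne_zero]
      rintro rfl
      exact hz.2 (by simp)
    have hψne : ∀ z, z ≠ p → ψ z = ψ₀ z := fun z hz => Function.update_of_ne hz _ _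
    have hO : IsOpen (ball c R \ (F : Set ℂ)) := isOpen_ball.sdiff F.finite_toSet.isClosed
    have hψ : DifferentiableOn ℂ ψ (ball c R \ F) := by
      have hsd : (ball c R \ (F : Set ℂ)) \ {p} = ball c R \ (insert p F : Finset ℂ) := by
        ext z; simp; tauto
      by_cases hp : p ∈ ball c R
      · refine Complex.differentiableOn_update_limUnder_of_isLittleO
          (hO.mem_nhds ⟨hp, by simpa using hpF⟩) (by rwa [hsd]) ?_
        refine (Asymptotics.isLittleO_iff_tendsto' ?_).2 ?_
        · filter_upwards [self_mem_nhdsWithin] with z hz h0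
          exact absurd (sub_eq_zero.1 (inv_eq_zero.1 h0)) hz
        · have h1 : Tendsto (fun z : ℂ => z - p) (𝓝[≠] p) (𝓝 0) := by
            have : ContinuousAt (fun z : ℂ => z - p) p := by fun_prop
            simpa [ContinuousAt] using this.tendsto.mono_left nhdsWithin_le_nhds
          have h2 : Tendsto (fun z => (z - p) * φ z - m - (z - p) * ψ₀ p) (𝓝[≠] p) (𝓝 0) := by
            simpa using (hm.sub_const (m : ℂ)).sub (h1.mul_const (ψ₀ p))
          refine h2.congr' ?_
          filter_upwards [self_mem_nhdsWithin] with z hz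
          have hz' : z - p ≠ 0 := sub_ne_zero.2 hz
          rw [div_inv_eq_mul]
          simp only [ψ₀]
          generalize φ p - m / (p - p) = k
          field_simp
      · have hsub : ball c R \ (F : Set ℂ) = ball c R \ (insert p F : Finset ℂ) := by
          rw [← hsd, sdiff_singleton_eq_self]
          exact fun h => hp h.1
        rw [hsub]
        refine hψ₀.congr fun z hz => hψne z ?_
        rintro rfl
        exact hz.2 (by simp)
    obtain ⟨H, hH, hHd⟩ := ih ψ hψ (by
      intro q hq
      obtain ⟨k, hk⟩ := hres q (Finset.mem_insert_of_mem hq)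
      have hqp : q ≠ p := by rintro rfl; exact hpF hq
      refine ⟨k, ?_⟩
      have h1 : Tendsto (fun z : ℂ => (z - q) * (m / (z - p))) (𝓝[≠] q) (𝓝 0) := by
        have : ContinuousAt (fun z : ℂ => (z - q) * (m / (z - p))) q := by
          have := sub_ne_zero.2 hqp
          fun_prop (disch := assumption)
        simpa [ContinuousAt] using this.tendsto.mono_left nhdsWithin_le_nhds
      have h2 := hk.sub h1
      rw [sub_zero] at h2
      refine h2.congr' ?_
      filter_upwards [nhdsWithin_le_nhds (isOpen_ne.mem_nhds hqp)] with z hz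
      rw [hψne z hz]
      simp only [ψ₀]
      ring)
    refine ⟨fun z => (z - p) ^ m * H z, DifferentiableOn.mul (by fun_prop) hH, fun z hz => ?_⟩
    have hzp : z ≠ p := by rintro rfl; exact hz.2 (by simp)
    have hzp' : z - p ≠ 0 := sub_ne_zero.2 hzp
    have hzF : z ∈ ball c R \ (F : Set ℂ) := ⟨hz.1, fun h => hz.2 (by simp [h])⟩
    obtain ⟨hne, hd⟩ := hHd z hzF
    refine ⟨mul_ne_zero (pow_ne_zero _ hzp') hne, ?_⟩
    have e1 := (hH.differentiableAt (isOpen_ball.mem_nhds hz.1)).hasDerivAt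
    have e2 : HasDerivAt (fun z : ℂ => (z - p) ^ m) (m * (z - p) ^ (m - 1)) z := by
      simpa using ((hasDerivAt_id z).sub_const p).fun_pow m
    rw [(e2.fun_mul e1).deriv, hd, hψne z hzp]
    simp only [ψ₀]
    rcases m with _ | m
    · simp
    · rw [Nat.add_sub_cancel, pow_succ]
      field_simp
      ring

/-- A function on `ℂ` whose singularities form a closed discrete set and are simple poles with
natural residues is the logarithmic derivative of an entire function. -/
theorem exists_entire_deriv_eq_mul {S : Set ℂ} (hS : IsClosed S) (hSd : DiscreteTopology S)
    {φ : ℂ → ℂ} (hφ : DifferentiableOn ℂ φ Sᶜ)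
    (hres : ∀ p ∈ S, ∃ m : ℕ, Tendsto (fun z => (z - p) * φ z) (𝓝[Sᶜ] p) (𝓝 (m : ℂ)))
    {a c : ℂ} (ha : a ∉ S) (hc : c ≠ 0) :
    ∃ H : ℂ → ℂ, Differentiable ℂ H ∧ H a = c ∧ ∀ z ∉ S, deriv H z = φ z * H z := by
  have hres' : ∀ p ∈ S, ∃ m : ℕ, Tendsto (fun z => (z - p) * φ z) (𝓝[≠] p) (𝓝 (m : ℂ)) := by
    intro p hp
    obtain ⟨m, hm⟩ := hres p hp
    exact ⟨m, hm.mono_left (le_inf nhdsWithin_le_nhds (le_principal_iff.2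
      (disjoint_principal_right.1 (disjoint_iff.2 (discreteTopology_subtype_iff.1 hSd p hp)))))⟩
  have hball : ∀ k : ℕ, ∃ H : ℂ → ℂ, DifferentiableOn ℂ H (ball a (k + 1)) ∧ H a = c ∧
      ∀ z ∈ ball a (k + 1) \ S, deriv H z = φ z * H z := by
    intro k
    have hfin : (closedBall a (k + 1) ∩ S).Finite :=
      ((isCompact_closedBall a _).inter_right hS).finite (.mono ⟨hSd⟩ inter_subset_right)
    have hsub : ball a (k + 1) \ (hfin.toFinset : Set ℂ) ⊆ Sᶜ := fun z hz hzS =>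
      hz.2 (by simpa using ⟨ball_subset_closedBall hz.1, hzS⟩)
    obtain ⟨H, hH, hHd⟩ := exists_deriv_eq_mul_ball_finset a (k + 1) hfin.toFinset φ
      (hφ.mono hsub) (fun p hp => hres' p ((hfin.mem_toFinset.1 hp).2))
    have hmem : ∀ z ∈ ball a ((k : ℝ) + 1) \ S, z ∈ ball a ((k : ℝ) + 1) \ (hfin.toFinset : Set ℂ) :=
      fun z hz => ⟨hz.1, fun h => hz.2 (hfin.mem_toFinset.1 h).2⟩
    have hne := (hHd a (hmem a ⟨mem_ball_self (by positivity), ha⟩)).1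
    refine ⟨fun z => c / H a * H z, hH.const_mul _, div_mul_cancel₀ _ hne, fun z hz => ?_⟩
    rw [deriv_const_mul _ (hH.differentiableAt (isOpen_ball.mem_nhds hz.1)),
      (hHd z (hmem z hz)).2]
    ring
  choose H hH hHa hHd using hball
  have hmono : ∀ j k : ℕ, j ≤ k → EqOn (H j) (H k) (ball a (j + 1)) := by
    intro j k hjk
    have hsub : ball a ((j : ℝ) + 1) ⊆ ball a (k + 1) := ball_subset_ball (by gcongr)
    exact eqOn_of_deriv_eq_mul hS isOpen_ball (convex_ball _ _).isPreconnected (hH j)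
      ((hH k).mono hsub) (hHd j) (fun z hz => hHd k z ⟨hsub hz.1, hz.2⟩)
      ⟨mem_ball_self (by positivity), ha⟩ ((hHa j).trans (hHa k).symm) (by rwa [hHa])
  let K : ℂ → ℂ := fun z => H ⌈dist z a⌉₊ z
  have hK : ∀ k : ℕ, EqOn K (H k) (ball a (k + 1)) := by
    intro k z hz
    have hz' : z ∈ ball a ((⌈dist z a⌉₊ : ℝ) + 1) :=
      mem_ball.2 ((Nat.le_ceil _).trans_lt (lt_add_one _))
    rcases le_total ⌈dist z a⌉₊ k with hle | hle
    · exact hmono _ _ hle hz'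
    · exact (hmono _ _ hle hz).symm
  have hev : ∀ z : ℂ, ∃ k : ℕ, z ∈ ball a ((k : ℝ) + 1) ∧ K =ᶠ[𝓝 z] H k := fun z =>
    have hz : z ∈ ball a ((⌈dist z a⌉₊ : ℝ) + 1) :=
      mem_ball.2 ((Nat.le_ceil _).trans_lt (lt_add_one _))
    ⟨_, hz, (hK _).eventuallyEq_of_mem (isOpen_ball.mem_nhds hz)⟩
  refine ⟨K, fun z => ?_, ?_, fun z hz => ?_⟩
  · obtain ⟨k, hk, he⟩ := hev z
    exact ((hH k).differentiableAt (isOpen_ball.mem_nhds hk)).congr_of_eventuallyEq he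
  · rw [hK 0 (mem_ball_self (by positivity)), hHa]
  · obtain ⟨k, hk, he⟩ := hev z
    rw [he.deriv_eq, he.eq_of_nhds, hHd k z ⟨hk, hz⟩]

theorem TopologicalSpace.countable_of_discreteTopology_subtype {S : Set ℂ}
    (hS : DiscreteTopology S) : S.Countable :=
  (TopologicalSpace.separableSpace_iff_countable (α := S)).1 inferInstance

/-- Transport of the value of a solution of `H' = φ H` along a segment. -/
theorem eq_mul_exp_integral_segment {φ H : ℂ → ℂ} {b z : ℂ} (hH : Differentiable ℂ H)
    (hφ : ∀ t ∈ Icc (0 : ℝ) 1, ContinuousAt φ (b + t * (z - b)))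
    (hd : ∀ t ∈ Icc (0 : ℝ) 1,
      deriv H (b + t * (z - b)) = φ (b + t * (z - b)) * H (b + t * (z - b))) :
    H z = H b * Complex.exp (∫ t in (0 : ℝ)..1, φ (b + t * (z - b)) * (z - b)) := by
  let k : ℝ → ℂ := fun t => φ (b + t * (z - b)) * (z - b)
  have hk : ∀ t ∈ Icc (0 : ℝ) 1, ContinuousAt k t := fun t ht =>
    (ContinuousAt.comp (f := fun t : ℝ => b + t * (z - b)) (hφ t ht)
      (by fun_prop)).mul continuousAt_const
  have hkc : ContinuousOn k (Icc 0 1) := fun t ht => (hk t ht).continuousWithinAt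
  have hki : IntervalIntegrable k MeasureTheory.volume 0 1 :=
    ContinuousOn.intervalIntegrable (by rwa [uIcc_of_le zero_le_one])
  let I : ℝ → ℂ := fun t => ∫ s in (0 : ℝ)..t, k s
  have hIc : ContinuousOn I (Icc 0 1) := by
    have := intervalIntegral.continuousOn_primitive_interval' hki left_mem_uIcc
    rwa [uIcc_of_le zero_le_one] at this
  have hId : ∀ t ∈ Ico (0 : ℝ) 1, HasDerivWithinAt I (k t) (Ici t) t := by
    intro t ht
    have hsub : IntervalIntegrable k MeasureTheory.volume 0 t :=
      hki.mono_set (by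
        rw [uIcc_of_le ht.1, uIcc_of_le zero_le_one]; exact Icc_subset_Icc_right ht.2.le)
    refine intervalIntegral.integral_hasDerivWithinAt_right hsub (s := Ici t) (t := Ioi t) ?_
      (hk t ⟨ht.1, ht.2.le⟩).continuousWithinAt
    refine ⟨Ioo t 1, Ioo_mem_nhdsGT ht.2, ?_⟩
    exact (hkc.mono fun s hs => ⟨ht.1.trans hs.1.le, hs.2.le⟩).aestronglyMeasurable
      measurableSet_Ioo
  let y : ℝ → ℂ := fun t => H (b + t * (z - b))
  have hyd : ∀ t ∈ Icc (0 : ℝ) 1, HasDerivAt y (k t * y t) t := by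
    intro t ht
    have hl : HasDerivAt (fun t : ℝ => b + t * (z - b)) (z - b) t := by
      simpa using ((Complex.ofRealCLM.hasDerivAt (x := t)).mul_const (z - b)).const_add b
    have hH' := (hH (b + t * (z - b))).hasDerivAt
    have := hH'.comp_of_eq t hl rfl
    rw [hd t ht] at this
    exact this.congr_deriv (by simp only [k, y]; ring)
  have hconst := constant_of_has_deriv_right_zero (f := fun t => y t * Complex.exp (-I t))
    (a := 0) (b := 1)
    (ContinuousOn.mul (fun t ht => (hyd t ht).continuousAt.continuousWithinAt) hIc.neg.cexp)
    (fun t ht => by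
      have := ((hyd t ⟨ht.1, ht.2.le⟩).hasDerivWithinAt (s := Ici t)).mul (hId t ht).neg.cexp
      exact this.congr_deriv (by ring)) 1 (right_mem_Icc.2 zero_le_one)
  have hI0 : I 0 = 0 := intervalIntegral.integral_same
  simp only [y, hI0, Complex.ofReal_one, Complex.ofReal_zero, one_mul, zero_mul, neg_zero,
    Complex.exp_zero, mul_one, add_zero, add_sub_cancel] at hconst
  change H z = H b * Complex.exp (I 1)
  rw [← hconst, mul_assoc, ← Complex.exp_add, neg_add_cancel, Complex.exp_zero, mul_one]

section

variable {W : Type*} [NormedAddCommGroup W] [NormedSpace ℂ W]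

/-- Analyticity of a family of solutions of `∂_z H = f H` propagates along segments of a slice. -/
theorem analyticAt_of_segment {Z : Set (ℂ × W)} (hZ : IsClosed Z) {f H : ℂ × W → ℂ}
    (hf : AnalyticOnNhd ℂ f Zᶜ) (hH : ∀ w, Differentiable ℂ fun z => H (z, w))
    (hd : ∀ p ∉ Z, deriv (fun z => H (z, p.2)) p.1 = f p * H p) {b z₀ : ℂ} {w₀ : W}
    (hseg : ∀ t ∈ Icc (0 : ℝ) 1, (b + t * (z₀ - b), w₀) ∉ Z)
    (hb : AnalyticAt ℂ H (b, w₀)) : AnalyticAt ℂ H (z₀, w₀) := by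
  let G : (ℂ × W) × ℂ → ℂ := fun x => f (b + x.2 * (x.1.1 - b), x.1.2) * (x.1.1 - b)
  have hG : ∀ t ∈ Icc (0 : ℝ) 1, AnalyticAt ℂ G ((z₀, w₀), (t : ℂ)) := by
    intro t ht
    have e₁ : AnalyticAt ℂ (fun x : (ℂ × W) × ℂ => x.1.1) ((z₀, w₀), (t : ℂ)) :=
      analyticAt_fst.comp_of_eq analyticAt_fst rfl
    have e₂ : AnalyticAt ℂ (fun x : (ℂ × W) × ℂ => x.1.2) ((z₀, w₀), (t : ℂ)) :=
      analyticAt_snd.comp_of_eq analyticAt_fst rfl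
    have e₃ : AnalyticAt ℂ (fun x : (ℂ × W) × ℂ => x.2) ((z₀, w₀), (t : ℂ)) := analyticAt_snd
    have h1 : AnalyticAt ℂ (fun x : (ℂ × W) × ℂ => (b + x.2 * (x.1.1 - b), x.1.2))
        ((z₀, w₀), (t : ℂ)) :=
      (analyticAt_const.add (e₃.mul (e₁.sub analyticAt_const))).prod e₂
    exact ((hf _ (hseg t ht)).comp_of_eq h1 rfl).mul (e₁.sub analyticAt_const)
  have hint := AnalyticAt.intervalIntegral Complex.continuous_ofReal zero_le_one hG
  have hb' : AnalyticAt ℂ (fun p : ℂ × W => H (b, p.2)) (z₀, w₀) :=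
    hb.comp_of_eq (analyticAt_const.prod analyticAt_snd) rfl
  refine (hb'.mul hint.cexp).congr ?_
  have hev : ∀ᶠ p : ℂ × W in 𝓝 (z₀, w₀), ∀ t ∈ Icc (0 : ℝ) 1,
      (b + t * (p.1 - b), p.2) ∈ Zᶜ := by
    refine isCompact_Icc.eventually_forall_of_forall_eventually fun t ht => ?_
    have hc : ContinuousAt (fun x : (ℂ × W) × ℝ => (b + (x.2 : ℂ) * (x.1.1 - b), x.1.2))
        ((z₀, w₀), t) := by fun_prop
    exact hc.eventually (hZ.isOpen_compl.mem_nhds (hseg t ht))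
  filter_upwards [hev] with p hp
  refine (eq_mul_exp_integral_segment (φ := fun z => f (z, p.2)) (hH p.2) (fun t ht => ?_)
    fun t ht => hd _ (hp t ht)).symm
  exact ContinuousAt.comp (f := fun z : ℂ => (z, p.2)) (hf _ (hp t ht)).continuousAt (by fun_prop)

/-- A function entire in `z` and jointly analytic near a circle in a slice is jointly analytic
at the centre. -/
theorem analyticAt_of_sphere {H : ℂ × W → ℂ} (hH : ∀ w, Differentiable ℂ fun z => H (z, w))
    {z₀ : ℂ} {w₀ : W} {r : ℝ} (hr : 0 < r)
    (hs : ∀ ζ ∈ sphere z₀ r, AnalyticAt ℂ H (ζ, w₀)) : AnalyticAt ℂ H (z₀, w₀) := by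
  let G : (ℂ × W) × ℂ → ℂ := fun x =>
    ((x.2 - z₀) * Complex.I) * ((x.2 - x.1.1)⁻¹ * H (x.2, x.1.2))
  have hG : ∀ θ ∈ Icc 0 (2 * Real.pi), AnalyticAt ℂ G ((z₀, w₀), circleMap z₀ r θ) := by
    intro θ _
    have e₁ : AnalyticAt ℂ (fun x : (ℂ × W) × ℂ => x.1.1) ((z₀, w₀), circleMap z₀ r θ) :=
      analyticAt_fst.comp_of_eq analyticAt_fst rfl
    have e₂ : AnalyticAt ℂ (fun x : (ℂ × W) × ℂ => x.1.2) ((z₀, w₀), circleMap z₀ r θ) :=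
      analyticAt_snd.comp_of_eq analyticAt_fst rfl
    have e₃ : AnalyticAt ℂ (fun x : (ℂ × W) × ℂ => x.2) ((z₀, w₀), circleMap z₀ r θ) := analyticAt_snd
    have hne : circleMap z₀ r θ - z₀ ≠ 0 := sub_ne_zero.2 (circleMap_ne_center hr.ne')
    have h1 : AnalyticAt ℂ (fun x : (ℂ × W) × ℂ => (x.2 - x.1.1)⁻¹)
        ((z₀, w₀), circleMap z₀ r θ) := AnalyticAt.inv (e₃.sub e₁) hne
    have h2 : AnalyticAt ℂ (fun x : (ℂ × W) × ℂ => H (x.2, x.1.2))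
        ((z₀, w₀), circleMap z₀ r θ) :=
      (hs _ (circleMap_mem_sphere _ hr.le θ)).comp_of_eq (e₃.prod e₂) rfl
    exact ((e₃.sub analyticAt_const).mul analyticAt_const).mul (h1.mul h2)
  have hint := AnalyticAt.intervalIntegral (continuous_circleMap z₀ r) Real.two_pi_pos.le hG
  refine ((analyticAt_const (v := (2 * (Real.pi : ℂ) * Complex.I)⁻¹)).mul hint).congr ?_
  have hmem : ∀ᶠ p : ℂ × W in 𝓝 (z₀, w₀), p.1 ∈ ball z₀ r :=
    continuousAt_fst.eventually (isOpen_ball.mem_nhds (mem_ball_self hr))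
  filter_upwards [hmem] with p hp
  have hC := Complex.two_pi_I_inv_smul_circleIntegral_sub_inv_smul_of_differentiable_on_off_countable
    countable_empty hp (hH p.2).continuous.continuousOn (fun z _ => hH p.2 z)
  simp only [circleIntegral, deriv_circleMap, smul_eq_mul] at hC
  rw [← hC]
  simp only [G, circleMap_sub_center, Pi.mul_apply]

/-- Slicewise entire solutions of `∂_z H = f H`, jointly analytic somewhere on every slice, are
jointly analytic. -/
theorem analyticOnNhd_univ_of_slices {Z : Set (ℂ × W)} (hZ : IsClosed Z)
    (hZd : ∀ w, DiscreteTopology {z : ℂ | (z, w) ∈ Z}) {f H : ℂ × W → ℂ}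
    (hf : AnalyticOnNhd ℂ f Zᶜ) (hH : ∀ w, Differentiable ℂ fun z => H (z, w))
    (hd : ∀ p ∉ Z, deriv (fun z => H (z, p.2)) p.1 = f p * H p)
    (hex : ∀ w, ∃ a, (a, w) ∉ Z ∧ AnalyticAt ℂ H (a, w)) : AnalyticOnNhd ℂ H univ := by
  rintro ⟨z₀, w₀⟩ -
  let S : Set ℂ := {z | (z, w₀) ∈ Z}
  have hS : IsClosed S := hZ.preimage (by fun_prop : Continuous fun z : ℂ => (z, w₀))
  have hconn : IsPreconnected Sᶜ :=
    ((TopologicalSpace.countable_of_discreteTopology_subtype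
      (hZd w₀)).isPathConnected_compl_of_one_lt_rank
        (by simp [Complex.rank_real_complex])).isConnected.isPreconnected
  let A : Set ℂ := {z | AnalyticAt ℂ H (z, w₀)}
  have hA : IsOpen A :=
    (isOpen_analyticAt ℂ H).preimage (by fun_prop : Continuous fun z : ℂ => (z, w₀))
  have hsub : Sᶜ ⊆ A := by
    obtain ⟨a, haZ, ha⟩ := hex w₀
    refine hconn.subset_of_closure_inter_subset hA ⟨a, haZ, ha⟩ fun z hz => ?_
    obtain ⟨r, hr, hball⟩ := Metric.isOpen_iff.1 hS.isOpen_compl z hz.2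
    obtain ⟨b, hbA, hb⟩ := Metric.mem_closure_iff.1 hz.1 r hr
    refine analyticAt_of_segment hZ hf hH hd (fun t ht => hball ?_) hbA
    have := (convex_ball z r).add_smul_sub_mem (x := b) (y := z) (by rwa [mem_ball'])
      (mem_ball_self hr) ht
    simpa using this
  by_cases hz : z₀ ∈ S
  · have hdis := disjoint_principal_right.1 (disjoint_iff.2
      (discreteTopology_subtype_iff.1 (hZd w₀) z₀ hz))
    obtain ⟨ε, hε, hball⟩ := Metric.mem_nhdsWithin_iff.1 hdis
    refine analyticAt_of_sphere hH (half_pos hε) fun ζ hζ => hsub (hball ⟨?_, ?_⟩)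
    · rw [mem_ball, mem_sphere.1 hζ]; exact half_lt_self hε
    · exact ne_of_mem_sphere hζ (half_pos hε).ne'
  · exact hsub hz

end

end


/-- Complex extension lemma.  Let `U ⊆ ℂⁿ = ℂ × ℂ^{n−1}` be open with every slice `U_w`
nonempty and connected, `h` holomorphic and nonvanishing on `U`, `Z` closed and disjoint
from `U` with discrete slices, and `f` holomorphic off `Z` with `f = ∂_z h / h` on `U`.
If `f` is meromorphic on `ℂⁿ` and each slice singularity of `f` is removable or a simple
pole with nonnegative-integer residue, then `h` extends to an entire function on `ℂⁿ`. -/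
theorem stmt9 {n : ℕ} (hn : 1 ≤ n)
    (U : Set (ℂ × (Fin (n - 1) → ℂ))) (hUopen : IsOpen U)
    (hslice : ∀ w : Fin (n - 1) → ℂ, IsConnected {z : ℂ | (z, w) ∈ U})
    (h : ℂ × (Fin (n - 1) → ℂ) → ℂ) (hh : AnalyticOnNhd ℂ h U)
    (hh0 : ∀ p ∈ U, h p ≠ 0)
    (Z : Set (ℂ × (Fin (n - 1) → ℂ))) (hZclosed : IsClosed Z) (hZU : Z ∩ U = ∅)
    (hZdisc : ∀ w : Fin (n - 1) → ℂ, DiscreteTopology {z : ℂ | (z, w) ∈ Z})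
    (f : ℂ × (Fin (n - 1) → ℂ) → ℂ) (hf : AnalyticOnNhd ℂ f Zᶜ)
    (hfU : ∀ p ∈ U, f p = deriv (fun z : ℂ => h (z, p.2)) p.1 / h p)
    (hmero : ∀ p : ℂ × (Fin (n - 1) → ℂ), ∃ V : Set (ℂ × (Fin (n - 1) → ℂ)),
        IsOpen V ∧ p ∈ V ∧ ∃ g q : ℂ × (Fin (n - 1) → ℂ) → ℂ,
          AnalyticOnNhd ℂ g V ∧ AnalyticOnNhd ℂ q V ∧
          (∀ O : Set (ℂ × (Fin (n - 1) → ℂ)), O ⊆ V → IsOpen O → O.Nonempty →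
            ∃ x ∈ O, q x ≠ 0) ∧
          Z ∩ V ⊆ {x | q x = 0} ∧
          (∀ x ∈ V \ Z, q x * f x = g x))
    (hres : ∀ p ∈ Z, ∃ m : ℕ,
        Filter.Tendsto (fun z' : ℂ => (z' - p.1) * f (z', p.2))
          (nhdsWithin p.1 {z' : ℂ | (z', p.2) ∉ Z}) (nhds (m : ℂ))) :
    ∃ ht : ℂ × (Fin (n - 1) → ℂ) → ℂ,
      AnalyticOnNhd ℂ ht Set.univ ∧ ∀ p ∈ U, ht p = h p := by
  have hZw : ∀ w, IsClosed {z : ℂ | (z, w) ∈ Z} := fun w =>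
    hZclosed.preimage (by fun_prop : Continuous fun z : ℂ => (z, w))
  have hUw : ∀ w, IsOpen {z : ℂ | (z, w) ∈ U} := fun w =>
    hUopen.preimage (by fun_prop : Continuous fun z : ℂ => (z, w))
  have hUZ : ∀ p ∈ U, p ∉ Z := fun p hpU hpZ => (hZU.subset ⟨hpZ, hpU⟩ : p ∈ (∅ : Set _))
  choose a ha using fun w => (hslice w).nonempty
  have hH : ∀ w, ∃ H : ℂ → ℂ, Differentiable ℂ H ∧ H (a w) = h (a w, w) ∧
      ∀ z ∉ {z : ℂ | (z, w) ∈ Z}, deriv H z = f (z, w) * H z := fun w =>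
    exists_entire_deriv_eq_mul (hZw w) (hZdisc w)
      (fun z hz => ((hf (z, w) hz).differentiableAt.comp (f := fun z : ℂ => (z, w)) z
        (by fun_prop)).differentiableWithinAt)
      (fun z hz => hres (z, w) hz) (hUZ _ (ha w)) (hh0 _ (ha w))
  choose H hHd hHa hHf using hH
  have hdiff : ∀ w, DifferentiableOn ℂ (fun z => h (z, w)) {z : ℂ | (z, w) ∈ U} :=
    fun w z hz => ((hh (z, w) hz).differentiableAt.comp (f := fun z : ℂ => (z, w)) z
      (by fun_prop)).differentiableWithinAt
  have hHU : ∀ p ∈ U, H p.2 p.1 = h p := fun p hp =>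
    eqOn_of_deriv_eq_mul (hZw p.2) (hUw p.2) (hslice p.2).isPreconnected
      (hHd p.2).differentiableOn (hdiff p.2) (fun z hz => hHf p.2 z hz.2)
      (fun z hz => by rw [hfU _ hz.1, div_mul_cancel₀ _ (hh0 _ hz.1)])
      ⟨ha p.2, hUZ _ (ha p.2)⟩ (hHa p.2) (hh0 _ (ha p.2)) hp
  refine ⟨fun p => H p.2 p.1, analyticOnNhd_univ_of_slices hZclosed hZdisc hf hHd
    (fun p hp => hHf p.2 p.1 hp) fun w => ⟨a w, hUZ _ (ha w), ?_⟩, hHU⟩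
  exact (hh _ (ha w)).congr
    ((show Set.EqOn h (fun p => H p.2 p.1) U from fun p hp => (hHU p hp).symm).eventuallyEq_of_mem
      (hUopen.mem_nhds (ha w)))
end

section
/- Let k ≥ 1 be an integer and ν > k a real number. Then the set of tuples (λ₀, …, λ_k) ∈ (ℝ^k)^{k+1} for which there exists C > 0 such that for every ξ ∈ ℝ^k with ‖ξ‖ ≥ C there is an index ℓ ∈ {0, …, k} with |e^{i⟨λ_ℓ, ξ⟩} − 1| ≥ ‖ξ‖^{−ν} (i.e. the set of ν-Diophantine (k+1)-tuples) has full Lebesgue measure: its complement in (ℝ^k)^{k+1} is a Lebesgue null set. -/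
open MeasureTheory RealInnerProductSpace

lemma summable_norm_int_rpow {k : ℕ} {ν : ℝ} (hν : (k : ℝ) < ν) :
    Summable fun p : Fin k → ℤ ↦ ‖p‖ ^ (-ν) := by
  let L := Submodule.span ℤ (Set.range (Pi.basisFun ℝ (Fin k)))
  have hmem (p : Fin k → ℤ) : (fun i ↦ (p i : ℝ)) ∈ L :=
    (Module.Basis.mem_span_iff_repr_mem ℤ _ _).2 fun i ↦ ⟨p i, by simp⟩
  have hrank : Module.finrank ℤ L = k := by
    rw [ZLattice.rank ℝ L]; simp
  have hsum := ZLattice.summable_norm_rpow L (-ν) (by rw [hrank]; linarith)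
  have hinj : Function.Injective fun p : Fin k → ℤ ↦ (⟨_, hmem p⟩ : L) := fun p q h ↦ by
    ext i
    exact Int.cast_injective (α := ℝ) (congrFun (congrArg Subtype.val h) i)
  refine (hsum.comp_injective hinj).congr fun p ↦ ?_
  have : ‖(fun i ↦ (p i : ℝ))‖ = ‖p‖ := by
    have hcoord (i : Fin k) : ‖(p i : ℝ)‖₊ = ‖p i‖₊ := NNReal.eq (Int.norm_cast_real _)
    simp only [Pi.norm_def, hcoord]
  simp [← this]

instance : IsProbabilityMeasure (volume : Measure UnitAddCircle) :=
  ⟨by simp⟩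

lemma volume_norm_sum_zsmul_le {k : ℕ} {p : Fin k → ℤ} (hp : p ≠ 0) (ε : ℝ) :
    volume {x : Fin k → UnitAddCircle | ‖∑ i, p i • x i‖ ≤ ε} ≤ ENNReal.ofReal (2 * ε) := by
  let f : (Fin k → UnitAddCircle) →+ UnitAddCircle :=
    { toFun := fun x ↦ ∑ i, p i • x i
      map_zero' := by simp
      map_add' := fun x y ↦ by simp [Finset.sum_add_distrib] }
  have hcont : Continuous f := by
    change Continuous fun x : Fin k → UnitAddCircle ↦ ∑ i, p i • x i
    fun_prop
  obtain ⟨j, hj⟩ := Function.ne_iff.1 hp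
  have hj' : (p j : ℝ) ≠ 0 := by exact_mod_cast hj
  have hsurj : Function.Surjective f := fun y ↦ by
    obtain ⟨t, rfl⟩ := QuotientAddGroup.mk_surjective y
    refine ⟨Pi.single j ((t / p j : ℝ) : UnitAddCircle), ?_⟩
    change ∑ i, p i • (Pi.single j ((t / p j : ℝ) : UnitAddCircle) : Fin k → UnitAddCircle) i = _
    rw [Finset.sum_eq_single j (fun i _ hi ↦ by simp [hi]) (by simp), Pi.single_eq_same,
      ← AddCircle.coe_zsmul, zsmul_eq_mul, mul_div_cancel₀ _ hj']
  have hf : MeasurePreserving f volume volume :=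
    AddMonoidHom.measurePreserving hcont hsurj (by simp)
  have hset : {x : Fin k → UnitAddCircle | ‖∑ i, p i • x i‖ ≤ ε}
      = f ⁻¹' Metric.closedBall 0 ε := by
    ext x
    simp [f]
  rw [hset, hf.measure_preimage Metric.isClosed_closedBall.measurableSet.nullMeasurableSet,
    AddCircle.volume_closedBall]
  exact ENNReal.ofReal_le_ofReal (min_le_right _ _)

lemma ae_finite_norm_sum_zsmul_le {k : ℕ} {ν : ℝ} (hν : (k : ℝ) < ν) (C : ℝ) :
    ∀ᵐ x : Fin k → UnitAddCircle, {p : Fin k → ℤ | ‖∑ i, p i • x i‖ ≤ C * ‖p‖ ^ (-ν)}.Finite := by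
  refine ae_finite_setOfPred_mem
    (s := fun p : Fin k → ℤ ↦ {x : Fin k → UnitAddCircle | ‖∑ i, p i • x i‖ ≤ C * ‖p‖ ^ (-ν)})
    (ne_top_of_le_ne_top (b := ∑' p : Fin k → ℤ,
      (ENNReal.ofReal (2 * (C * ‖p‖ ^ (-ν))) + if p = 0 then 1 else 0)) ?_ ?_)
  · rw [ENNReal.tsum_add, tsum_ite_eq]
    exact ENNReal.add_ne_top.2
      ⟨((summable_norm_int_rpow hν).mul_left C |>.mul_left 2).tsum_ofReal_ne_top, by simp⟩
  · refine ENNReal.tsum_le_tsum fun p ↦ ?_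
    by_cases hp : p = 0
    · refine le_add_left (prob_le_one.trans ?_)
      simp [hp]
    · exact le_add_right (volume_norm_sum_zsmul_le hp _)

/-- Vectors `μ` admitting, for some constant, infinitely many approximate integer relations
`∑ i, p i * μ i ∈ ℤ` of quality `‖p‖ ^ (-ν)`. -/
def wellApproximableForms (k : ℕ) (ν : ℝ) : Set (Fin k → ℝ) :=
  {μ | ∃ n : ℕ, {p : Fin k → ℤ |
    ‖((∑ i, p i * μ i : ℝ) : UnitAddCircle)‖ ≤ n * ‖p‖ ^ (-ν)}.Infinite}

lemma volume_wellApproximableForms {k : ℕ} {ν : ℝ} (hν : (k : ℝ) < ν) :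
    volume (wellApproximableForms k ν) = 0 := by
  have hae : ∀ᵐ x : Fin k → UnitAddCircle, ∀ n : ℕ,
      {p : Fin k → ℤ | ‖∑ i, p i • x i‖ ≤ n * ‖p‖ ^ (-ν)}.Finite :=
    ae_all_iff.2 fun n ↦ ae_finite_norm_sum_zsmul_le hν n
  have hcube (a : Fin k → ℤ) : ∀ᵐ μ : Fin k → ℝ,
      μ ∈ Set.univ.pi (fun i ↦ Set.Ioc (a i : ℝ) (a i + 1)) → μ ∉ wellApproximableForms k ν := by
    rw [← ae_restrict_iff' (MeasurableSet.univ_pi fun _ ↦ measurableSet_Ioc)]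
    have hmp := measurePreserving_pi _ _ fun i ↦ UnitAddCircle.measurePreserving_mk (a i : ℝ)
    rw [← Measure.restrict_pi_pi] at hmp
    filter_upwards [hmp.quasiMeasurePreserving.ae hae] with μ hμ
    rintro ⟨n, hn⟩
    refine hn ((hμ n).subset fun p hp ↦ ?_)
    simp only [Set.mem_ofPred_eq] at hp ⊢
    convert hp using 2
    push_cast [← zsmul_eq_mul]
    simp
  rw [measure_eq_zero_iff_ae_notMem]
  filter_upwards [ae_all_iff.2 hcube] with μ hμ
  exact hμ (fun i ↦ ⌈μ i⌉ - 1) fun i _ ↦ by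
    constructor
    · push_cast; linarith [Int.ceil_lt_add_one (μ i)]
    · push_cast; linarith [Int.le_ceil (μ i)]

lemma measurable_det_of_euclidean {k : ℕ} :
    Measurable fun A : Fin k → EuclideanSpace ℝ (Fin k) ↦ (Matrix.of fun i j ↦ A i j).det := by
  refine Continuous.measurable ?_
  exact Continuous.matrix_det (by fun_prop)

lemma ae_det_ne_zero (k : ℕ) :
    ∀ᵐ A : Fin k → EuclideanSpace ℝ (Fin k), (Matrix.of fun i j ↦ A i j).det ≠ 0 := by
  let D : Fin k → EuclideanSpace ℝ (Fin k) := fun i ↦ EuclideanSpace.single i 1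
  have hmeas : MeasurableSet {x : (Fin k → EuclideanSpace ℝ (Fin k)) × ℝ |
      (Matrix.of fun i j ↦ (x.1 + x.2 • D) i j).det ≠ 0} := by
    have hD : Measurable fun x : (Fin k → EuclideanSpace ℝ (Fin k)) × ℝ ↦ x.1 + x.2 • D :=
      Continuous.measurable (by fun_prop)
    exact (measurable_det_of_euclidean.comp hD) (MeasurableSet.singleton (0 : ℝ)).compl
  have hline : ∀ᵐ A : Fin k → EuclideanSpace ℝ (Fin k), ∀ᵐ t : ℝ,
      (Matrix.of fun i j ↦ (A + t • D) i j).det ≠ 0 := by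
    refine .of_forall fun A ↦ ?_
    let M : Matrix (Fin k) (Fin k) ℝ := Matrix.of fun i j ↦ A i j
    have hfin := Polynomial.finite_setOfPred_isRoot (Matrix.charpoly_monic (-M)).ne_zero
    refine (measure_mono_null (fun t ht ↦ ?_) (hfin.measure_zero volume))
    simp only [Set.mem_compl_iff, Set.mem_ofPred_eq, not_not] at ht
    rw [Set.mem_ofPred_eq, Polynomial.IsRoot, Matrix.eval_charpoly, ← ht]
    congr 1
    ext i j
    simp [M, D, Matrix.scalar_apply, Matrix.diagonal_apply, eq_comm, add_comm]
  obtain ⟨t, ht⟩ := ((Measure.ae_ae_comm hmeas).1 hline).exists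
  have hmp := measurePreserving_add_right
    (volume : Measure (Fin k → EuclideanSpace ℝ (Fin k))) (-(t • D))
  filter_upwards [hmp.quasiMeasurePreserving.ae ht] with A hA
  simpa using hA

lemma abs_sub_round_le_norm_exp_sub_one (θ : ℝ) :
    |θ / (2 * Real.pi) - round (θ / (2 * Real.pi))| ≤ ‖Complex.exp (Complex.I * θ) - 1‖ := by
  set n := round (θ / (2 * Real.pi)) with hn
  set δ := θ / (2 * Real.pi) - n with hδ
  have hδ2 : |δ| ≤ 1 / 2 := abs_sub_round _
  have hθ : θ / 2 = Real.pi * δ + n * Real.pi := by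
    rw [hδ]; field_simp; ring
  have habs : |Real.sin (θ / 2)| = |Real.sin (Real.pi * δ)| := by
    rw [hθ, Real.sin_add_int_mul_pi, abs_mul]; simp
  have hb : |Real.pi * δ| ≤ Real.pi / 2 := by
    rw [abs_mul, abs_of_pos Real.pi_pos]
    nlinarith [Real.pi_pos]
  have := Real.mul_abs_le_abs_sin hb
  rw [abs_mul, abs_of_pos Real.pi_pos, ← mul_assoc, div_mul_cancel₀ _ Real.pi_ne_zero] at this
  rw [Complex.norm_exp_I_mul_ofReal_sub_one, norm_mul, Real.norm_eq_abs, Real.norm_eq_abs, habs,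
    abs_two]
  linarith [abs_nonneg δ]

lemma exists_norm_le_mul_norm_mulVec {k : ℕ} {M : Matrix (Fin k) (Fin k) ℝ} (hM : M.det ≠ 0) :
    ∃ K : ℝ, 0 < K ∧ ∀ ξ : EuclideanSpace ℝ (Fin k), ‖ξ‖ ≤ K * ‖M.mulVec ξ‖ := by
  let T : (Fin k → ℝ) →L[ℝ] EuclideanSpace ℝ (Fin k) :=
    (EuclideanSpace.equiv (Fin k) ℝ).symm.toContinuousLinearMap.comp
      (LinearMap.toContinuousLinearMap M⁻¹.mulVecLin)
  refine ⟨‖T‖ + 1, by positivity, fun ξ ↦ ?_⟩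
  have hT : T (M.mulVec ξ) = ξ := by
    simp [T, Matrix.mulVec_mulVec, Matrix.nonsing_inv_mul M (isUnit_iff_ne_zero.2 hM)]
  calc ‖ξ‖ = ‖T (M.mulVec ξ)‖ := by rw [hT]
    _ ≤ ‖T‖ * ‖M.mulVec ξ‖ := T.le_opNorm _
    _ ≤ _ := by gcongr; linarith

lemma vecMul_inv_mem_wellApproximableForms {k : ℕ} {ν : ℝ} (hν : 0 ≤ ν)
    {A : Fin k → EuclideanSpace ℝ (Fin k)} {v : EuclideanSpace ℝ (Fin k)}
    {M : Matrix (Fin k) (Fin k) ℝ} (hMA : M = Matrix.of fun i j ↦ A i j) (hM : M.det ≠ 0)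
    (h : ∀ C > (0 : ℝ), ∃ ξ : EuclideanSpace ℝ (Fin k), C ≤ ‖ξ‖ ∧
      ‖Complex.exp (Complex.I * (⟪v, ξ⟫ : ℝ)) - 1‖ < ‖ξ‖ ^ (-ν) ∧
      ∀ i, ‖Complex.exp (Complex.I * (⟪A i, ξ⟫ : ℝ)) - 1‖ < ‖ξ‖ ^ (-ν)) :
    Matrix.vecMul v M⁻¹ ∈ wellApproximableForms k ν := by
  set μ : Fin k → ℝ := Matrix.vecMul v M⁻¹ with hμ
  obtain ⟨K, hK, hKξ⟩ := exists_norm_le_mul_norm_mulVec hM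
  have hinner (ξ : EuclideanSpace ℝ (Fin k)) (i : Fin k) : M.mulVec ξ i = ⟪A i, ξ⟫ := by
    simp [hMA, Matrix.mulVec, dotProduct, PiLp.inner_apply, mul_comm]
  have hv (ξ : EuclideanSpace ℝ (Fin k)) : ∑ i, μ i * ⟪A i, ξ⟫ = ⟪v, ξ⟫ := by
    have h1 : ∑ i, μ i * ⟪A i, ξ⟫ = dotProduct μ (M.mulVec ξ) := by
      simp [dotProduct, hinner]
    rw [h1, Matrix.dotProduct_mulVec, hμ, Matrix.vecMul_vecMul,
      Matrix.nonsing_inv_mul M (isUnit_iff_ne_zero.2 hM), Matrix.vecMul_one]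
    simp [dotProduct, PiLp.inner_apply, mul_comm]
  set B : ℝ := ‖A‖ + 1 with hB
  have hBpos : 0 < B := by positivity
  set S : ℝ := 1 + ∑ i, |μ i| with hS
  have hSpos : 0 < S := by positivity
  obtain ⟨n, hn⟩ := exists_nat_ge (S * B ^ ν)
  refine ⟨n, fun hfin ↦ ?_⟩
  obtain ⟨b, hb⟩ := hfin.isBounded.exists_norm_le
  obtain ⟨ξ, hξ, hξv, hξA⟩ := h (1 + K * (2 * Real.pi * (|b| + 1))) (by positivity)
  have hξ1 : 1 ≤ ‖ξ‖ := le_trans (by simp; positivity) hξ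
  have hξpos : 0 < ‖ξ‖ := by linarith
  let p : Fin k → ℤ := fun i ↦ round (⟪A i, ξ⟫ / (2 * Real.pi))
  have hpi : 1 ≤ 2 * Real.pi := by linarith [Real.pi_gt_three]
  have hround (i : Fin k) : |⟪A i, ξ⟫ / (2 * Real.pi) - p i| ≤ 1 / 2 := abs_sub_round _
  have hpA (i : Fin k) : |⟪A i, ξ⟫ / (2 * Real.pi) - p i| ≤ ‖ξ‖ ^ (-ν) :=
    (abs_sub_round_le_norm_exp_sub_one _).trans (hξA i).le
  have hpB : ‖p‖ ≤ B * ‖ξ‖ := by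
    refine (pi_norm_le_iff_of_nonneg (by positivity)).2 fun i ↦ ?_
    have h1 : |⟪A i, ξ⟫ / (2 * Real.pi)| ≤ ‖A‖ * ‖ξ‖ := by
      rw [abs_div, abs_of_pos (by positivity : (0 : ℝ) < 2 * Real.pi)]
      refine (div_le_self (abs_nonneg _) hpi).trans ((abs_real_inner_le_norm _ _).trans ?_)
      gcongr
      exact norm_le_pi_norm A i
    rw [← Int.norm_cast_real, Real.norm_eq_abs]
    have h2 := abs_le.1 (hround i)
    have h3 := abs_le.1 h1
    rw [abs_le]
    constructor <;> nlinarith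
  have hbp : |b| < ‖p‖ := by
    by_contra! hle
    have h1 : ‖M.mulVec ξ‖ ≤ 2 * Real.pi * (|b| + 1) := by
      refine (pi_norm_le_iff_of_nonneg (by positivity)).2 fun i ↦ ?_
      have h2 : |(p i : ℝ)| ≤ |b| := by
        rw [← Real.norm_eq_abs, Int.norm_cast_real]
        exact (norm_le_pi_norm p i).trans hle
      have h3 : |⟪A i, ξ⟫ / (2 * Real.pi)| ≤ |b| + 1 := by
        have h4 := abs_le.1 (hround i)
        have h5 := abs_le.1 h2
        rw [abs_le]
        constructor <;> linarith
      rw [abs_div, abs_of_pos (by positivity : (0 : ℝ) < 2 * Real.pi),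
        div_le_iff₀ (by positivity)] at h3
      rw [hinner, Real.norm_eq_abs]
      linarith
    have h2 := (hKξ ξ).trans (mul_le_mul_of_nonneg_left h1 hK.le)
    linarith
  have hppos : 0 < ‖p‖ := (abs_nonneg b).trans_lt hbp
  refine absurd (hb p ?_) (not_le.2 ((le_abs_self b).trans_lt hbp))
  have hpow : ‖ξ‖ ^ (-ν) ≤ B ^ ν * ‖p‖ ^ (-ν) := by
    have h1 : (B * ‖ξ‖) ^ (-ν) ≤ ‖p‖ ^ (-ν) :=
      Real.rpow_le_rpow_of_nonpos hppos hpB (by linarith)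
    rw [Real.mul_rpow hBpos.le hξpos.le] at h1
    calc ‖ξ‖ ^ (-ν) = B ^ ν * (B ^ (-ν) * ‖ξ‖ ^ (-ν)) := by
          rw [← mul_assoc, ← Real.rpow_add hBpos]; simp
      _ ≤ _ := by gcongr
  have hform : |∑ i, p i * μ i - round (⟪v, ξ⟫ / (2 * Real.pi))| ≤ S * ‖ξ‖ ^ (-ν) := by
    have h1 : ∑ i, p i * μ i - round (⟪v, ξ⟫ / (2 * Real.pi))
        = (⟪v, ξ⟫ / (2 * Real.pi) - round (⟪v, ξ⟫ / (2 * Real.pi)))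
          - ∑ i, μ i * (⟪A i, ξ⟫ / (2 * Real.pi) - p i) := by
      simp_rw [mul_sub, Finset.sum_sub_distrib, ← mul_div_assoc, ← Finset.sum_div, hv,
        mul_comm (μ _) (p _ : ℝ)]
      ring
    rw [h1, hS, add_mul, one_mul, Finset.sum_mul]
    refine (abs_sub _ _).trans (add_le_add
      ((abs_sub_round_le_norm_exp_sub_one _).trans hξv.le)
      ((Finset.abs_sum_le_sum_abs _ _).trans (Finset.sum_le_sum fun i _ ↦ ?_)))
    rw [abs_mul]
    exact mul_le_mul_of_nonneg_left (hpA i) (abs_nonneg _)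
  rw [Set.mem_ofPred_eq, UnitAddCircle.norm_eq]
  calc _ ≤ _ := round_le _ _
    _ ≤ _ := hform
    _ ≤ S * (B ^ ν * ‖p‖ ^ (-ν)) := by gcongr
    _ ≤ n * ‖p‖ ^ (-ν) := by rw [← mul_assoc]; gcongr

lemma volume_det_or_vecMul_inv_mem {k : ℕ} {N : Set (Fin k → ℝ)} (hNm : MeasurableSet N)
    (hN : volume N = 0) :
    volume {x : EuclideanSpace ℝ (Fin k) × (Fin k → EuclideanSpace ℝ (Fin k)) |
      (Matrix.of fun i j ↦ x.2 i j).det = 0 ∨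
        Matrix.vecMul x.1 (Matrix.of fun i j ↦ x.2 i j)⁻¹ ∈ N} = 0 := by
  have hdet := measurable_det_of_euclidean (k := k)
  have hmeas : MeasurableSet {x : EuclideanSpace ℝ (Fin k) × (Fin k → EuclideanSpace ℝ (Fin k)) |
      (Matrix.of fun i j ↦ x.2 i j).det = 0 ∨
        Matrix.vecMul x.1 (Matrix.of fun i j ↦ x.2 i j)⁻¹ ∈ N} := by
    refine MeasurableSet.union ((hdet.comp measurable_snd) (MeasurableSet.singleton (0 : ℝ))) ?_
    have hadj : Measurable fun x : EuclideanSpace ℝ (Fin k) × (Fin k → EuclideanSpace ℝ (Fin k)) ↦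
        Matrix.vecMul x.1 (Matrix.of fun i j ↦ x.2 i j).adjugate :=
      Continuous.measurable (Continuous.matrix_vecMul (by fun_prop)
        (Continuous.matrix_adjugate (by fun_prop)))
    have hinv := (hdet.comp (measurable_snd
      (α := EuclideanSpace ℝ (Fin k)))).inv.smul hadj
    refine (?_ : Measurable fun x : EuclideanSpace ℝ (Fin k) ×
      (Fin k → EuclideanSpace ℝ (Fin k)) ↦
        Matrix.vecMul x.1 (Matrix.of fun i j ↦ x.2 i j)⁻¹) hNm
    convert hinv using 2 with x
    simp [Matrix.inv_def, Matrix.vecMul_smul]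
  rw [Measure.volume_eq_prod, Measure.prod_apply_symm hmeas,
    lintegral_eq_zero_iff (measurable_measure_prodMk_right hmeas)]
  filter_upwards [ae_det_ne_zero k] with A hA
  set M : Matrix (Fin k) (Fin k) ℝ := Matrix.of fun i j ↦ A i j with hM
  have hlin : volume (Matrix.toLin' M⁻¹.transpose ⁻¹' N) = 0 := by
    rw [Measure.addHaar_preimage_linearMap, hN, mul_zero]
    simpa [LinearMap.det_toLin', Matrix.det_nonsing_inv] using hA
  refine measure_mono_null (fun v hv ↦ ?_)
    ((PiLp.volume_preserving_ofLp (Fin k)).quasiMeasurePreserving.preimage_null hlin)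
  have hvN := hv.resolve_left hA
  rwa [← Matrix.mulVec_transpose] at hvN

/-- For `ν > k`, almost every `(k+1)`-tuple `(λ₀, …, λ_k)` of vectors of `ℝ^k` is
`ν`-Diophantine: there is `C > 0` such that for every `ξ ∈ ℝ^k` with `‖ξ‖ ≥ C` some
index `ℓ` satisfies `|e^{i⟨λ_ℓ, ξ⟩} − 1| ≥ ‖ξ‖^{−ν}`.  Equivalently, the complement of
the set of `ν`-Diophantine tuples is a Lebesgue null set in `(ℝ^k)^{k+1}`. -/
theorem stmt10 (k : ℕ) (hk : 1 ≤ k) (ν : ℝ) (hν : (k : ℝ) < ν) :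
    volume {lam : Fin (k + 1) → EuclideanSpace ℝ (Fin k) |
      ¬ ∃ C > (0:ℝ), ∀ ξ : EuclideanSpace ℝ (Fin k), C ≤ ‖ξ‖ →
        ∃ ℓ : Fin (k + 1),
          ‖ξ‖ ^ (-ν) ≤ ‖Complex.exp (Complex.I * (⟪lam ℓ, ξ⟫ : ℝ)) - 1‖} = 0 := by
  have hmp := volume_preserving_piFinSuccAbove
    (fun _ : Fin (k + 1) ↦ EuclideanSpace ℝ (Fin k)) 0
  refine measure_mono_null (fun lam h ↦ ?_) (hmp.quasiMeasurePreserving.preimage_null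
    (volume_det_or_vecMul_inv_mem (measurableSet_toMeasurable volume (wellApproximableForms k ν))
      ((measure_toMeasurable _).trans (volume_wellApproximableForms hν))))
  refine or_iff_not_imp_left.2 fun hdet ↦ subset_toMeasurable _ _ <|
    vecMul_inv_mem_wellApproximableForms ((Nat.cast_nonneg k).trans hν.le) rfl hdet fun C hC ↦ ?_
  simp only [Set.mem_ofPred_eq] at h
  push Not at h
  obtain ⟨ξ, hξ, hlt⟩ := h C hC
  exact ⟨ξ, hξ, hlt 0, fun i ↦ hlt _⟩
end
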